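/- (Corollary) Let n ≥ 2 and let x ∈ ℤ^{n²} be a solution of the generalized Sudoku problem with permutations π₁, π₂, π₃, indices i₁, …, i_k and givens g_{i₁}, …, g_{i_k}. Then for each l = 1, …, k and each r = 1, 2, 3, the given g_{i_l} equals the i_l-th component of ½ (A_{π_r}ᵀ sgn(A_{π_r} x) + (n+1)·1_{n²}); equivalently 2·g_{i_l} = [A_{π_r}ᵀ sgn(A_{π_r} x)]_{i_l} + (n+1). -/

import Mathlib

open Matrix

/-- The difference matrix `A(n)`: rows are indexed by pairs `(i, j)` with `i < j`,
row `(i, j)` has entry `+1` in column `i`, entry `-1` in column `j`, and `0` elsewhere. -/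
def Amat (n : ℕ) : Matrix {p : Fin n × Fin n // p.1 < p.2} (Fin n) ℤ :=
  fun p k => if k = p.val.1 then 1 else if k = p.val.2 then -1 else 0

/-- The `(n·s(n)) × n²` block-diagonal matrix `A` with `n` copies of `A(n)` along the
diagonal and zeros elsewhere.  Columns are indexed by `Fin (n * n)` in the row-major
layout `(r, j) ↦ r·n + j` given by `finProdFinEquiv`. -/
def bigA (n : ℕ) : Matrix (Fin n × {p : Fin n × Fin n // p.1 < p.2}) (Fin (n * n)) ℤ :=
  fun r c =>
    if (finProdFinEquiv.symm c).1 = r.1 then Amat n r.2 (finProdFinEquiv.symm c).2 else 0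

/-- `A_π`: the matrix `A` with columns permuted by `π`, i.e. the `j`-th column of `A_π`
is the `π⁻¹(j)`-th column of `A`. -/
def Aperm (n : ℕ) (π : Equiv.Perm (Fin (n * n))) :
    Matrix (Fin n × {p : Fin n × Fin n // p.1 < p.2}) (Fin (n * n)) ℤ :=
  (bigA n).submatrix id ⇑π.symm

theorem Amat_mulVec (n : ℕ) (y : Fin n → ℤ) (p : {p : Fin n × Fin n // p.1 < p.2}) :
    (Amat n *ᵥ y) p = y p.val.1 - y p.val.2 := by
  have hne : p.val.2 ≠ p.val.1 := p.2.ne'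
  have hsplit : ∀ k, Amat n p k * y k =
      (if k = p.val.1 then y k else 0) - (if k = p.val.2 then y k else 0) := by
    intro k
    unfold Amat
    split_ifs with h1 h2 <;> first | (exact absurd (h2.symm.trans h1) hne) | ring
  simp [Matrix.mulVec, dotProduct, hsplit, Finset.sum_sub_distrib]

/-- For an antisymmetric `S`, the transpose of `A(n)` turns the upper triangle of `S`
into its row sums. -/
theorem Amat_transpose_mulVec (n : ℕ) (S : Fin n → Fin n → ℤ)
    (hS : ∀ i j, S j i = -S i j) (b : Fin n) :
    ((Amat n)ᵀ *ᵥ fun p => S p.val.1 p.val.2) b = ∑ j, S b j := by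
  have hdiag : S b b = 0 := by have := hS b b; omega
  have hsub : ((Amat n)ᵀ *ᵥ fun p => S p.val.1 p.val.2) b =
      ∑ p : Fin n × Fin n, if p.1 < p.2 then
        (if b = p.1 then 1 else if b = p.2 then -1 else 0) * S p.1 p.2 else 0 := by
    rw [← Finset.sum_filter]
    exact (Finset.sum_subtype _ (by simp)
      (fun p : Fin n × Fin n =>
        (if b = p.1 then 1 else if b = p.2 then -1 else 0) * S p.1 p.2)).symm
  have hterm : ∀ i j : Fin n, (if i < j then
      (if b = i then 1 else if b = j then -1 else 0) * S i j else 0) =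
      (if b = i then (if b < j then S b j else 0) else 0) +
        (if b = j then (if i < b then S b i else 0) else 0) := by
    intro i j
    have := hS i j
    grind
  rw [hsub, Fintype.sum_prod_type]
  simp only [hterm, Finset.sum_add_distrib]
  rw [Finset.sum_comm]
  simp only [Finset.sum_ite_eq, Finset.mem_univ, if_true]
  rw [← Finset.sum_add_distrib]
  refine Finset.sum_congr rfl fun j _ => ?_
  rcases lt_trichotomy b j with h | h | h
  · simp [h, h.not_gt]
  · subst h; simp [hdiag]
  · simp [h, h.not_gt]

theorem sum_sign_sub_Icc (n : ℕ) (v : ℤ) (h1 : 1 ≤ v) (hn : v ≤ n) :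
    ∑ m ∈ Finset.Icc (1 : ℤ) n, Int.sign (v - m) = 2 * v - (n + 1) := by
  have hsign : ∀ m : ℤ, Int.sign (v - m) =
      (if m < v then 1 else 0) - (if v < m then 1 else 0) := by
    intro m
    rcases lt_trichotomy m v with h | h | h
    · rw [Int.sign_eq_one_of_pos (by omega)]; simp [h, h.not_gt]
    · simp [h]
    · rw [Int.sign_eq_neg_one_of_neg (by omega)]; simp [h, h.not_gt]
  have hlt : (Finset.Icc (1 : ℤ) n).filter (· < v) = Finset.Icc 1 (v - 1) := by
    ext m; simp only [Finset.mem_filter, Finset.mem_Icc]; omega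
  have hgt : (Finset.Icc (1 : ℤ) n).filter (v < ·) = Finset.Icc (v + 1) n := by
    ext m; simp only [Finset.mem_filter, Finset.mem_Icc]; omega
  simp only [hsign, Finset.sum_sub_distrib, Finset.sum_boole, hlt, hgt, Int.card_Icc]
  omega

/-- An injective `y : Fin n → ℤ` with values in `[1, n]` takes each value once, so the sum of
the signs of `y b - y j` determines `y b`. -/
theorem sum_sign_sub_of_injective (n : ℕ) (y : Fin n → ℤ) (hy : Function.Injective y)
    (hb : ∀ j, 1 ≤ y j ∧ y j ≤ n) (b : Fin n) :
    ∑ j, Int.sign (y b - y j) = 2 * y b - (n + 1) := by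
  have himg : Finset.univ.image y = Finset.Icc (1 : ℤ) n := by
    apply Finset.eq_of_subset_of_card_le
    · intro m hm
      obtain ⟨j, -, rfl⟩ := Finset.mem_image.1 hm
      exact Finset.mem_Icc.2 (hb j)
    · rw [Finset.card_image_of_injective _ hy]
      simp
  rw [← sum_sign_sub_Icc n (y b) (hb b).1 (hb b).2, ← himg,
    Finset.sum_image fun _ _ _ _ h => hy h]

theorem Aperm_mulVec (n : ℕ) (π : Equiv.Perm (Fin (n * n))) (x : Fin (n * n) → ℤ)
    (a : Fin n) (p : {p : Fin n × Fin n // p.1 < p.2}) :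
    (Aperm n π *ᵥ x) (a, p) = (Amat n *ᵥ fun j => x (π (finProdFinEquiv (a, j)))) p := by
  simp only [Matrix.mulVec, dotProduct]
  rw [← Equiv.sum_comp (finProdFinEquiv.trans π), Fintype.sum_prod_type, Finset.sum_comm]
  simp [Aperm, bigA, ite_mul]

theorem Aperm_transpose_mulVec (n : ℕ) (π : Equiv.Perm (Fin (n * n)))
    (w : Fin n × {p : Fin n × Fin n // p.1 < p.2} → ℤ) (a b : Fin n) :
    ((Aperm n π)ᵀ *ᵥ w) (π (finProdFinEquiv (a, b))) =
      ((Amat n)ᵀ *ᵥ fun p => w (a, p)) b := by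
  simp only [Matrix.mulVec, dotProduct]
  rw [Fintype.sum_prod_type, Finset.sum_comm]
  simp [Aperm, bigA, ite_mul]

/-- Corollary: for every solution `x` of the generalized Sudoku problem, each given `g l`
satisfies `2·g_{i_l} = [A_{π_r}ᵀ sgn(A_{π_r} x)]_{i_l} + (n+1)` for each `r = 1, 2, 3`. -/
theorem generalized_sudoku_necessary_givens (n : ℕ) (hn : 2 ≤ n)
    (π : Fin 3 → Equiv.Perm (Fin (n * n)))
    (k : ℕ) (hk : k ≤ n * n) (idx : Fin k → Fin (n * n)) (g : Fin k → ℤ)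
    (hg : ∀ l, 1 ≤ g l ∧ g l ≤ (n : ℤ))
    (x : Fin (n * n) → ℤ)
    (hxb : ∀ i, 1 ≤ x i ∧ x i ≤ (n : ℤ))
    (hxA : ∀ r p, (Aperm n (π r) *ᵥ x) p ≠ 0)
    (hxg : ∀ l, x (idx l) = g l) :
    ∀ (l : Fin k) (r : Fin 3),
      2 * g l =
        ((Aperm n (π r))ᵀ *ᵥ fun p => Int.sign ((Aperm n (π r) *ᵥ x) p)) (idx l) +
          ((n : ℤ) + 1) := by
  intro l r
  obtain ⟨⟨a, b⟩, hab⟩ := (finProdFinEquiv.trans (π r)).surjective (idx l)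
  simp only [Equiv.trans_apply] at hab
  set y : Fin n → ℤ := fun j => x (π r (finProdFinEquiv (a, j)))
  have hrow : ∀ p, (Aperm n (π r) *ᵥ x) (a, p) = y p.val.1 - y p.val.2 := fun p => by
    rw [Aperm_mulVec, Amat_mulVec]
  have hinj : Function.Injective y :=
    Function.Injective.of_lt_imp_ne fun i j hij h => hxA r (a, ⟨(i, j), hij⟩) (by simp [hrow, h])
  have hyb : y b = g l := by rw [← hxg, ← hab]
  rw [← hab, Aperm_transpose_mulVec]
  simp only [hrow]
  rw [Amat_transpose_mulVec n (fun i j => Int.sign (y i - y j))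
      (fun i j => by rw [← Int.sign_neg, neg_sub]),
    sum_sign_sub_of_injective n y hinj (fun j => hxb _) b, hyb]
  ring
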